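/- arXiv:1301.5727 — 2 statements merged into one kernel-verified Lean document; each statement's English description precedes it below -/
import Mathlib

section
/- Let H : C(X,E) → C(Y,E) be a strongly pointwise subadditive separating map such that H(1_{e₀})(y) ≠ 0 for all y ∈ Y, with support map h : Y → X. If h is injective, then H is detaching. -/
open Set

variable {X Y E : Type*} [TopologicalSpace X] [CompactSpace X] [T2Space X]
  [TopologicalSpace Y] [CompactSpace Y] [T2Space Y]
  [NormedRing E] [NormedAlgebra ℂ E] [CompleteSpace E]

/-- The cozero set of a continuous function. -/
def coz (f : C(X, E)) : Set X := {x | f x ≠ 0}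

/-- `H` is separating. -/
def Separating (H : C(X, E) → C(Y, E)) : Prop :=
  ∀ f g : C(X, E), (∀ x : X, ‖f x‖ * ‖g x‖ = 0) → ∀ y : Y, ‖H f y‖ * ‖H g y‖ = 0

/-- `H` is pointwise subadditive. -/
def PointwiseSubadditive (H : C(X, E) → C(Y, E)) : Prop :=
  ∀ f g : C(X, E), ∀ y : Y, ‖H (f + g) y‖ ≤ ‖H f y‖ + ‖H g y‖

/-- `H` is subadditive (with respect to supremum norms). -/
def SubadditiveMap (H : C(X, E) → C(Y, E)) : Prop :=
  ∀ f g : C(X, E), ‖H (f + g)‖ ≤ ‖H f‖ + ‖H g‖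

/-- `H` is strongly subadditive. -/
def StronglySubadditive (H : C(X, E) → C(Y, E)) : Prop :=
  SubadditiveMap H ∧ ∃ M > (0 : ℝ), ∀ f : C(X, E), ∃ ε > (0 : ℝ),
    ∀ g : C(X, E), ‖f - g‖ < ε → ‖H f - H g‖ ≤ M * ‖H (f - g)‖

/-- `U` is a vanishing set for `ŷ ∘ H`. -/
def IsVanishingSet (H : C(X, E) → C(Y, E)) (y : Y) (U : Set X) : Prop :=
  IsOpen U ∧ ∀ f : C(X, E), coz f ⊆ U → H f y = 0

/-- The support of `ŷ ∘ H` : the complement of the union of all vanishing sets. -/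
def suppSet (H : C(X, E) → C(Y, E)) (y : Y) : Set X :=
  (⋃ U ∈ {U : Set X | IsVanishingSet H y U}, U)ᶜ

/-- `H` is strongly pointwise subadditive with respect to a support map `h`. -/
def StronglyPointwiseSubadditive (H : C(X, E) → C(Y, E)) (h : Y → X) : Prop :=
  ∀ y : Y, ∃ M > (0 : ℝ), ∀ c : E, ∃ δ > (0 : ℝ), ∀ f g : C(X, E),
    f (h y) = c → ‖f (h y) - g (h y)‖ < δ →
      ‖H f y - H g y‖ ≤ M * ‖H (f - g) y‖

/-- `H` is detaching. -/
def Detaching (H : C(X, E) → C(Y, E)) : Prop :=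
  ∀ y y' : Y, y ≠ y' → ∃ f g : C(X, E),
    coz f ∩ coz g = ∅ ∧ ‖H f y‖ * ‖H g y'‖ ≠ 0

/-- `H` is norm-bounded. -/
def NormBounded (H : C(X, E) → C(Y, E)) : Prop :=
  ∃ D > (0 : ℝ), ∀ f : C(X, E), ‖H f‖ ≤ D * ‖f‖

/-- `H` is `1_{e₀}`-bounded. -/
def OneBounded (H : C(X, E) → C(Y, E)) : Prop :=
  ∃ D > (0 : ℝ), ∀ e : E,
    ‖H (ContinuousMap.const X e)‖ ≤ D * ‖H (ContinuousMap.const X (1 : E))‖ * ‖e‖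

/-- Every open neighbourhood of a point of the support carries a function not killed by `ŷ ∘ H`. -/
theorem exists_coz_subset_of_mem_suppSet {X Y E : Type*} [TopologicalSpace X]
    [TopologicalSpace Y] [NormedRing E] {H : C(X, E) → C(Y, E)} {y : Y} {x : X}
    (hx : x ∈ suppSet H y) {U : Set X} (hU : IsOpen U) (hxU : x ∈ U) :
    ∃ f : C(X, E), coz f ⊆ U ∧ H f y ≠ 0 := by
  by_contra! hvan
  exact hx (mem_biUnion (show IsVanishingSet H y U from ⟨hU, hvan⟩) hxU)

/-- if the support map `h` is injective, then `H` is detaching. -/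
theorem stmt_11 (H : C(X, E) → C(Y, E))
    (hsep : Separating H)
    (hsub : PointwiseSubadditive H)
    (hone : ∀ y : Y, H (ContinuousMap.const X (1 : E)) y ≠ 0)
    (h : Y → X) (hsupp : ∀ y : Y, suppSet H y = {h y})
    (hstrong : StronglyPointwiseSubadditive H h)
    (hinj : Function.Injective h) :
    Detaching H := by
  intro y y' hne
  obtain ⟨U, V, hU, hV, hyU, hyV, hUV⟩ := t2_separation (hinj.ne hne)
  obtain ⟨f, hfU, hf⟩ :=
    exists_coz_subset_of_mem_suppSet (hsupp y ▸ mem_singleton (h y)) hU hyU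
  obtain ⟨g, hgV, hg⟩ :=
    exists_coz_subset_of_mem_suppSet (hsupp y' ▸ mem_singleton (h y')) hV hyV
  exact ⟨f, g, (hUV.mono hfU hgV).inter_eq,
    mul_ne_zero (norm_ne_zero_iff.2 hf) (norm_ne_zero_iff.2 hg)⟩
end

section
/- Let H : C(X,E) → C(Y,E) be a separating, strongly pointwise subadditive map with H(1_{e₀})(y) ≠ 0 for all y ∈ Y and support map h : Y → X, and suppose H is 1_{e₀}-bounded. Then y belongs to the continuity set Y_c of H if and only if Hf(y) = H(1_{f(h(y))})(y) for all f ∈ C(X,E). -/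
open Set

variable {X Y E : Type*} [TopologicalSpace X] [CompactSpace X] [T2Space X]
  [TopologicalSpace Y] [CompactSpace Y] [T2Space Y]
  [NormedRing E] [NormedAlgebra ℂ E] [CompleteSpace E]

/-- A continuous function vanishing at `x` is a uniform limit of functions vanishing near `x`. -/
theorem exists_eq_zero_on_nhd_norm_sub_le (f : C(X, E)) {x : X} (hx : f x = 0) {ε : ℝ}
    (hε : 0 < ε) : ∃ g : C(X, E), (∃ U, IsOpen U ∧ x ∈ U ∧ ∀ z ∈ U, g z = 0) ∧ ‖f - g‖ ≤ ε := by
  have hpos : ∀ t : ℝ, 0 < max t ε := fun t => lt_max_of_lt_right hε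
  have hcont : Continuous fun z => ((max (‖f z‖ - ε) 0 / max ‖f z‖ ε : ℝ) : ℂ) • f z := by
    refine (Complex.continuous_ofReal.comp (Continuous.div ?_ ?_ fun z => (hpos _).ne')).smul
      f.continuous <;> fun_prop
  refine ⟨⟨_, hcont⟩, ⟨{z | ‖f z‖ < ε}, isOpen_lt (by fun_prop) continuous_const, ?_, ?_⟩, ?_⟩
  · simpa [hx] using hε
  · intro z hz
    have hz' : ‖f z‖ - ε ≤ 0 := by
      have : ‖f z‖ < ε := hz
      linarith
    simp [max_eq_right hz']
  · refine (ContinuousMap.norm_le _ hε.le).2 fun z => ?_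
    have hcoeff : 1 - max (‖f z‖ - ε) 0 / max ‖f z‖ ε = ε / max ‖f z‖ ε := by
      have hmax : max (‖f z‖ - ε) 0 = max ‖f z‖ ε - ε := by
        rw [← max_sub_sub_right, sub_self]
      rw [hmax, sub_div, div_self (hpos _).ne', sub_sub_cancel]
    have hdiff : f z - ((max (‖f z‖ - ε) 0 / max ‖f z‖ ε : ℝ) : ℂ) • f z =
        ((ε / max ‖f z‖ ε : ℝ) : ℂ) • f z := by
      rw [← hcoeff, Complex.ofReal_sub, Complex.ofReal_one, sub_smul, one_smul]
    change ‖f z - ((max (‖f z‖ - ε) 0 / max ‖f z‖ ε : ℝ) : ℂ) • f z‖ ≤ ε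
    rw [hdiff, norm_smul, Complex.norm_real, Real.norm_of_nonneg (div_pos hε (hpos _)).le,
      div_mul_eq_mul_div, div_le_iff₀ (hpos _)]
    gcongr
    exact le_max_left _ _

/-- If `f` vanishes near a support point of `ŷ ∘ H`, then `H f y = 0`. -/
theorem Separating.apply_eq_zero {H : C(X, E) → C(Y, E)} (hsep : Separating H) {y : Y} {x : X}
    (hx : x ∈ suppSet H y) {f : C(X, E)} {U : Set X} (hU : IsOpen U) (hxU : x ∈ U)
    (hf : ∀ z ∈ U, f z = 0) : H f y = 0 := by
  have hnot : ¬ IsVanishingSet H y U := fun hv => hx (mem_biUnion (show U ∈ {U | _} from hv) hxU)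
  obtain ⟨g, hg, hgy⟩ : ∃ g : C(X, E), coz g ⊆ U ∧ H g y ≠ 0 := by
    by_contra! hcon
    exact hnot ⟨hU, hcon⟩
  have hprod : ‖H f y‖ * ‖H g y‖ = 0 := hsep f g (fun z => by
    by_cases hz : g z = 0
    · simp [hz]
    · simp [hf z (hg hz)]) y
  simpa [hgy] using hprod

/-- if `H` is moreover `1_{e₀}`-bounded, then `y` belongs to the
continuity set iff `H f y = H (1_{f (h y)}) y` for all `f`. -/
theorem stmt_16 (H : C(X, E) → C(Y, E))
    (hsep : Separating H)
    (hsub : PointwiseSubadditive H)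
    (hone : ∀ y : Y, H (ContinuousMap.const X (1 : E)) y ≠ 0)
    (h : Y → X) (hsupp : ∀ y : Y, suppSet H y = {h y})
    (hstrong : StronglyPointwiseSubadditive H h)
    (hb : OneBounded H) (y : Y) :
    (Continuous fun f : C(X, E) => H f y) ↔
      ∀ f : C(X, E), H f y = H (ContinuousMap.const X (f (h y))) y := by
  obtain ⟨M, hM, hMc⟩ := hstrong y
  have hmem : h y ∈ suppSet H y := by rw [hsupp y]; rfl
  constructor
  · intro hc f
    have hzero : ∀ f : C(X, E), f (h y) = 0 → H f y = 0 := by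
      intro f hf
      by_contra hne
      obtain ⟨ε, hε, hball⟩ := Metric.eventually_nhds_iff.1
        (hc.continuousAt.eventually_ne (x := f) hne)
      obtain ⟨g, ⟨U, hU, hyU, hgU⟩, hfg⟩ :=
        exists_eq_zero_on_nhd_norm_sub_le f hf (half_pos hε)
      refine hball (y := g) ?_ (hsep.apply_eq_zero hmem hU hyU hgU)
      rw [dist_comm, dist_eq_norm]
      linarith
    obtain ⟨δ, hδ, hδM⟩ := hMc (f (h y))
    have hle := hδM f (ContinuousMap.const X (f (h y))) rfl (by simpa using hδ)
    rw [hzero (f - ContinuousMap.const X (f (h y))) (by simp), norm_zero, mul_zero] at hle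
    exact sub_eq_zero.1 (norm_le_zero_iff.1 hle)
  · intro hH
    obtain ⟨D, hD, hDb⟩ := hb
    refine continuous_iff_continuousAt.2 fun f => ?_
    obtain ⟨δ, hδ, hδM⟩ := hMc (f (h y))
    set K := M * (D * ‖H (ContinuousMap.const X (1 : E))‖)
    have hlim : Filter.Tendsto (fun g : C(X, E) => K * dist g f) (nhds f) (nhds 0) := by
      have : Continuous fun g : C(X, E) => K * dist g f := by fun_prop
      simpa using this.tendsto f
    refine tendsto_iff_dist_tendsto_zero.2
      (squeeze_zero' (Filter.Eventually.of_forall fun _ => dist_nonneg) ?_ hlim)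
    filter_upwards [Metric.ball_mem_nhds f hδ] with g hg
    have hnorm : ‖f (h y) - g (h y)‖ ≤ dist g f := by
      rw [dist_comm, dist_eq_norm]
      exact (f - g).norm_coe_le_norm (h y)
    calc dist (H g y) (H f y) = ‖H f y - H g y‖ := by rw [dist_comm, dist_eq_norm]
      _ ≤ M * ‖H (f - g) y‖ := hδM f g rfl (hnorm.trans_lt hg)
      _ = M * ‖H (ContinuousMap.const X ((f - g) (h y))) y‖ := by rw [hH (f - g)]
      _ ≤ M * (D * ‖H (ContinuousMap.const X (1 : E))‖ * dist g f) := by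
        gcongr
        refine (ContinuousMap.norm_coe_le_norm _ y).trans ((hDb _).trans ?_)
        gcongr
        exact hnorm
      _ = K * dist g f := by ring
end
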